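/- Let H be a normal subgroup of a finite group G and V an irreducible G-module over a field. If there is no proper subgroup J with H ≤ J < G and irreducible J-module W such that V is induced from W, then the restriction of V to H is a direct sum of isomorphic irreducible H-modules. -/

import Mathlib

namespace CliffordAux

variable {k : Type} [Field k] {G : Type} [Group G]
    {V : Type} [AddCommGroup V] [Module k V] (ρ : Representation k G V) (H : Subgroup G)

/-- The image of the group algebra of `H` in the endomorphisms of `V`. -/
abbrev alg : Subalgebra k (Module.End k V) := Algebra.adjoin k (ρ '' (H : Set G))

/-- The element of `alg` given by `h ∈ H`. -/
abbrev el (h : G) (hh : h ∈ H) : alg ρ H := ⟨ρ h, Algebra.subset_adjoin ⟨h, hh, rfl⟩⟩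

/-- Shortcut instance. -/
instance smulInst (m : Submodule (alg ρ H) V) : SMul (alg ρ H) m :=
  (Submodule.module m).toDistribMulAction.toMulAction.toSMul

/-- An `H`-invariant subspace as a submodule. -/
def ofInv (U : Submodule k V) (hU : ∀ h ∈ H, ∀ v ∈ U, ρ h v ∈ U) : Submodule (alg ρ H) V where
  carrier := U
  add_mem' := fun ha hb => U.add_mem ha hb
  zero_mem' := U.zero_mem
  smul_mem' := by
    rintro ⟨a, ha⟩ v hv
    change a v ∈ U
    induction ha using Algebra.adjoin_induction generalizing v with
    | mem x hx => obtain ⟨h, hh, rfl⟩ := hx; exact hU h hh v hv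
    | algebraMap r => simpa using U.smul_mem r hv
    | add x y _ _ hx hy => exact U.add_mem (hx hv) (hy hv)
    | mul x y _ _ hx hy => exact hx (hy hv)

@[simp] lemma mem_ofInv {U : Submodule k V} {hU} {v : V} : v ∈ ofInv ρ H U hU ↔ v ∈ U := Iff.rfl

lemma inv_mem (m : Submodule (alg ρ H) V) (h : G) (hh : h ∈ H) (v : V) (hv : v ∈ m) :
    ρ h v ∈ m := m.smul_mem (el ρ H h hh) hv

lemma rho_inv_self (g : G) (v : V) : ρ g⁻¹ (ρ g v) = v := by
  rw [← Module.End.mul_apply, ← map_mul]; simp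

lemma rho_self_inv (g : G) (v : V) : ρ g (ρ g⁻¹ v) = v := by
  rw [← Module.End.mul_apply, ← map_mul]; simp

/-- A `k`-linear equivalence commuting with `H` is linear. -/
def mkEquiv {m m' : Submodule (alg ρ H) V} (e : m ≃ₗ[k] m')
    (he : ∀ h (hh : h ∈ H) (v : m), e (el ρ H h hh • v) = el ρ H h hh • e v) :
    m ≃ₗ[alg ρ H] m' where
  __ := e.toAddEquiv
  map_smul' := by
    rintro ⟨a, ha⟩ v
    change e ((⟨a, ha⟩ : alg ρ H) • v) = (⟨a, ha⟩ : alg ρ H) • e v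
    induction ha using Algebra.adjoin_induction generalizing v with
    | mem x hx => obtain ⟨h, hh, rfl⟩ := hx; exact he h hh v
    | algebraMap r =>
      have h1 : ∀ w : m, (⟨algebraMap k _ r, Subalgebra.algebraMap_mem _ r⟩ : alg ρ H) • w = r • w :=
        fun w => Subtype.ext (by rfl)
      have h2 : ∀ w : m', (⟨algebraMap k _ r, Subalgebra.algebraMap_mem _ r⟩ : alg ρ H) • w = r • w :=
        fun w => Subtype.ext (by rfl)
      rw [h1, h2, map_smul]
    | add x y hx' hy' hx hy =>
      have := congrArg₂ (· + ·) (hx v) (hy v)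
      simp only [← map_add, ← add_smul] at this
      exact this
    | mul x y hx' hy' hx hy =>
      have := hx ((⟨y, hy'⟩ : alg ρ H) • v)
      rw [hy v] at this
      simp only [← mul_smul] at this
      exact this

variable [H.Normal]

/-- Translate of a submodule by `g`. -/
def tr (g : G) (m : Submodule (alg ρ H) V) : Submodule (alg ρ H) V :=
  ofInv ρ H ((m.restrictScalars k).map (ρ g)) (by
    rintro h hh _ ⟨v, hv, rfl⟩
    refine ⟨ρ (g⁻¹ * h * g) v, inv_mem ρ H m _ ?_ v hv, ?_⟩
    · simpa using Subgroup.Normal.conj_mem ‹_› h hh g⁻¹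
    · simp only [← Module.End.mul_apply, ← map_mul]; congr 2; group)

lemma mem_tr {g : G} {m : Submodule (alg ρ H) V} {v : V} : v ∈ tr ρ H g m ↔ ρ g⁻¹ v ∈ m := by
  constructor
  · rintro ⟨w, hw, rfl⟩
    rw [rho_inv_self]; exact hw
  · intro h
    exact ⟨_, h, rho_self_inv ρ g v⟩

lemma tr_mul (g g' : G) (m : Submodule (alg ρ H) V) :
    tr ρ H (g * g') m = tr ρ H g (tr ρ H g' m) := by
  ext v; simp [mem_tr]

lemma tr_one (m : Submodule (alg ρ H) V) : tr ρ H 1 m = m := by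
  ext v; simp [mem_tr]

lemma tr_inv_tr (g : G) (m : Submodule (alg ρ H) V) : tr ρ H g⁻¹ (tr ρ H g m) = m := by
  rw [← tr_mul, inv_mul_cancel, tr_one]

lemma tr_tr_inv (g : G) (m : Submodule (alg ρ H) V) : tr ρ H g (tr ρ H g⁻¹ m) = m := by
  rw [← tr_mul, mul_inv_cancel, tr_one]

lemma tr_mono (g : G) {m m' : Submodule (alg ρ H) V} (h : m ≤ m') :
    tr ρ H g m ≤ tr ρ H g m' := by
  intro v hv
  rw [mem_tr] at *
  exact h hv

/-- Translation as an order isomorphism. -/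
def trIso (g : G) : Submodule (alg ρ H) V ≃o Submodule (alg ρ H) V where
  toFun := tr ρ H g
  invFun := tr ρ H g⁻¹
  left_inv := tr_inv_tr ρ H g
  right_inv := tr_tr_inv ρ H g
  map_rel_iff' := by
    intro a b
    refine ⟨fun h => ?_, fun h => tr_mono ρ H g h⟩
    have := tr_mono ρ H g⁻¹ h
    simpa [tr_inv_tr] using this

lemma tr_simple (g : G) (m : Submodule (alg ρ H) V) [hm : IsSimpleModule (alg ρ H) m] :
    IsSimpleModule (alg ρ H) (tr ρ H g m) := by
  rw [isSimpleModule_iff_isAtom] at *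
  exact ((trIso ρ H g).isAtom_iff m).2 hm

/-- Translation of submodules as a `k`-linear equivalence. -/
def trEquiv (g : G) (m : Submodule (alg ρ H) V) : m ≃ₗ[k] tr ρ H g m where
  toFun v := ⟨ρ g v, v, v.2, rfl⟩
  invFun v := ⟨ρ g⁻¹ v, (mem_tr ρ H).1 v.2⟩
  map_add' a b := Subtype.ext (by simp)
  map_smul' a b := Subtype.ext (by simp)
  left_inv v := Subtype.ext (rho_inv_self ρ g v)
  right_inv v := Subtype.ext (rho_self_inv ρ g v)

lemma tr_equiv (g : G) {m m' : Submodule (alg ρ H) V} (e : m ≃ₗ[alg ρ H] m') :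
    Nonempty (tr ρ H g m ≃ₗ[alg ρ H] tr ρ H g m') := by
  refine ⟨mkEquiv ρ H (((trEquiv ρ H g m).symm.trans (e.restrictScalars k)).trans
    (trEquiv ρ H g m')) ?_⟩
  intro h hh v
  obtain ⟨v, rfl⟩ := (trEquiv ρ H g m).surjective v
  have hh' : g⁻¹ * h * g ∈ H := by simpa using Subgroup.Normal.conj_mem ‹_› h hh g⁻¹
  have key : ∀ (n : Submodule (alg ρ H) V) (w : n),
      el ρ H h hh • trEquiv ρ H g n w = trEquiv ρ H g n (el ρ H _ hh' • w) := by
    intro n w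
    apply Subtype.ext
    change ρ h (ρ g w) = ρ g (ρ (g⁻¹ * h * g) w)
    simp only [← Module.End.mul_apply, ← map_mul]; congr 2; group
  rw [key]
  simp [key]

lemma tr_isotypic_le (g : G) (S : Submodule (alg ρ H) V) :
    tr ρ H g (isotypicComponent (alg ρ H) V S) ≤ isotypicComponent (alg ρ H) V (tr ρ H g S) := by
  change trIso ρ H g _ ≤ _
  rw [isotypicComponent, OrderIso.map_sSup]
  refine iSup₂_le fun m ⟨e⟩ => le_sSup (tr_equiv ρ H g e)

lemma tr_isotypic (g : G) (S : Submodule (alg ρ H) V) :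
    tr ρ H g (isotypicComponent (alg ρ H) V S) = isotypicComponent (alg ρ H) V (tr ρ H g S) := by
  refine le_antisymm (tr_isotypic_le ρ H g S) ?_
  have := tr_mono ρ H g (tr_isotypic_le ρ H g⁻¹ (tr ρ H g S))
  rwa [tr_tr_inv, tr_inv_tr] at this

lemma tr_of_mem (h : G) (hh : h ∈ H) (m : Submodule (alg ρ H) V) : tr ρ H h m = m := by
  ext v
  rw [mem_tr]
  refine ⟨fun hv => ?_, fun hv => inv_mem ρ H m _ (H.inv_mem hh) v hv⟩
  simpa [rho_self_inv] using inv_mem ρ H m h hh _ hv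

lemma eq_top_of_inv
    (hirr : ∀ W : Submodule k V, (∀ g : G, ∀ v ∈ W, ρ g v ∈ W) → W = ⊥ ∨ W = ⊤)
    (m : Submodule (alg ρ H) V) (hm : m ≠ ⊥) (hinv : ∀ g, tr ρ H g m ≤ m) : m = ⊤ := by
  rcases hirr (m.restrictScalars k) (fun g v hv => hinv g ⟨v, hv, rfl⟩) with h | h
  · exact absurd ((Submodule.restrictScalars_eq_bot_iff _ _ _).1 h) hm
  · exact (Submodule.restrictScalars_eq_top_iff _ _ _).1 h

lemma iSup_tr
    (hirr : ∀ W : Submodule k V, (∀ g : G, ∀ v ∈ W, ρ g v ∈ W) → W = ⊥ ∨ W = ⊤)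
    (m : Submodule (alg ρ H) V) (hm : m ≠ ⊥) : ⨆ g, tr ρ H g m = ⊤ := by
  apply eq_top_of_inv ρ H hirr
  · intro h
    apply hm
    rw [eq_bot_iff, ← h]
    exact (tr_one ρ H m).ge.trans (le_iSup (fun g => tr ρ H g m) 1)
  · intro g
    change trIso ρ H g _ ≤ _
    rw [OrderIso.map_iSup]
    refine iSup_le fun g' => ?_
    change tr ρ H g _ ≤ _
    rw [← tr_mul]
    exact le_iSup (fun g => tr ρ H g m) _


lemma indep_res {ι : Type} (f : ι → Submodule (alg ρ H) V) (hf : iSupIndep f) :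
    iSupIndep (fun i => (f i).restrictScalars k) := by
  intro i
  have := hf i
  simp only [← Submodule.restrictScalars_iSup]
  rw [Submodule.disjoint_def] at *
  exact this

/-- The stabilizer of a submodule. -/
def stab (C : Submodule (alg ρ H) V) : Subgroup G where
  carrier := {g | tr ρ H g C = C}
  one_mem' := tr_one ρ H C
  mul_mem' := by
    intro a b ha hb
    change tr ρ H (a * b) C = C
    rw [tr_mul, show tr ρ H b C = C from hb]; exact ha
  inv_mem' := by
    intro a ha
    change tr ρ H a⁻¹ C = C
    conv_lhs => rw [← show tr ρ H a C = C from ha]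
    exact tr_inv_tr ρ H a C

lemma mem_stab {C : Submodule (alg ρ H) V} {g : G} : g ∈ stab ρ H C ↔ tr ρ H g C = C := Iff.rfl

lemma exists_transversal [Finite G] (J : Subgroup G) :
    ∃ T : Finset G, ∀ g : G, ∃! t, t ∈ T ∧ t⁻¹ * g ∈ J := by
  classical
  have := Fintype.ofFinite (G ⧸ J)
  refine ⟨Finset.univ.image (Quotient.out : G ⧸ J → G), fun g => ⟨(g : G ⧸ J).out, ⟨by simp, ?_⟩, ?_⟩⟩
  · rw [← QuotientGroup.eq]; simp
  · rintro t ⟨ht, htg⟩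
    obtain ⟨q, -, rfl⟩ := Finset.mem_image.1 ht
    rw [← QuotientGroup.eq] at htg
    simp at htg
    rw [htg]

end CliffordAux

open CliffordAux in

/-- **Clifford / Serre, Proposition 24.** Let `H ⊴ G` with `G` finite and let
`V` be an irreducible `G`-module over a field `k`. If there is no proper subgroup `J` with
`H ≤ J < G` and irreducible `J`-submodule `W` such that `V` is induced from `W` (i.e. `V` is
the internal direct sum of the translates of `W` by a transversal of `J` in `G`), then the
restriction of `V` to `H` is a direct sum of isomorphic irreducible `H`-modules. -/
theorem clifford_isotypic_of_not_induced
    (k : Type) [Field k] (G : Type) [Group G] [Finite G]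
    (V : Type) [AddCommGroup V] [Module k V] [FiniteDimensional k V]
    (ρ : Representation k G V)
    (hnontriv : (⊥ : Submodule k V) ≠ ⊤)
    (hirr : ∀ W : Submodule k V, (∀ g : G, ∀ v ∈ W, ρ g v ∈ W) → W = ⊥ ∨ W = ⊤)
    (H : Subgroup G) [H.Normal]
    (hnotind : ¬ ∃ (J : Subgroup G) (W : Submodule k V) (T : Finset G),
      H ≤ J ∧ J ≠ ⊤ ∧
      -- `W` is a `J`-invariant subspace
      (∀ j ∈ J, ∀ v ∈ W, ρ j v ∈ W) ∧
      -- `W` is an irreducible `J`-module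
      W ≠ ⊥ ∧
      (∀ U : Submodule k V, U ≤ W → (∀ j ∈ J, ∀ v ∈ U, ρ j v ∈ U) → U = ⊥ ∨ U = W) ∧
      -- `T` is a transversal of `J` in `G`
      (∀ g : G, ∃! t, t ∈ T ∧ t⁻¹ * g ∈ J) ∧
      -- `V` is the internal direct sum of the translates of `W` by elements of `T`
      iSupIndep (fun t : T => W.map (ρ (t : G))) ∧
      (⨆ t : T, W.map (ρ (t : G))) = ⊤) :
    ∃ (s : ℕ) (S : Fin s → Submodule k V),
      -- each `S i` is `H`-invariant
      (∀ i, ∀ h ∈ H, ∀ v ∈ S i, ρ h v ∈ S i) ∧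
      -- each `S i` is a nonzero irreducible `H`-module
      (∀ i, S i ≠ ⊥) ∧
      (∀ i, ∀ U : Submodule k V, U ≤ S i → (∀ h ∈ H, ∀ v ∈ U, ρ h v ∈ U) →
        U = ⊥ ∨ U = S i) ∧
      -- `V` is the internal direct sum of the `S i`
      iSupIndep S ∧ (⨆ i, S i) = ⊤ ∧
      -- the `S i` are pairwise isomorphic as `H`-modules
      (∀ i j, ∃ e : (S i) ≃ₗ[k] (S j), ∀ h ∈ H, ∀ v v' : S i,
        (v' : V) = ρ h (v : V) → (e v' : V) = ρ h (e v : V)) := by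
  classical
  have hVn : Nontrivial V := (Submodule.nontrivial_iff k).1 ⟨⊥, ⊤, hnontriv⟩
  have hNoeth : IsNoetherian (alg ρ H) V := isNoetherian_of_tower k inferInstance
  have hArt : IsArtinian (alg ρ H) V := isArtinian_of_tower k inferInstance
  obtain ⟨S, hS⟩ := IsAtomic.exists_atom (Submodule (alg ρ H) V)
  have hSne := hS.1
  have hSs : IsSimpleModule (alg ρ H) S := isSimpleModule_iff_isAtom.2 hS
  have hss : IsSemisimpleModule (alg ρ H) V := by
    apply IsSemisimpleModule.of_sSup_simples_eq_top
    rw [eq_top_iff, ← iSup_tr ρ H hirr S hSne]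
    exact iSup_le fun g => le_sSup (tr_simple ρ H g S)
  obtain ⟨C, hC⟩ : ∃ C, C = isotypicComponent (alg ρ H) V S := ⟨_, rfl⟩
  have hCne : C ≠ ⊥ := hC ▸ (bot_lt_isotypicComponent S).ne'
  have htrC : ∀ g, tr ρ H g C ∈ isotypicComponents (alg ρ H) V := fun g =>
    ⟨tr ρ H g S, tr_simple ρ H g S, by rw [hC, tr_isotypic]⟩
  have hind := sSupIndep_isotypicComponents (alg ρ H) V
  have hHJ : H ≤ stab ρ H C := fun h hh => tr_of_mem ρ H h hh C
  by_cases hJ : stab ρ H C = ⊤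
  · have hCtop : C = ⊤ := eq_top_of_inv ρ H hirr C hCne fun g =>
      (show tr ρ H g C = C from (mem_stab ρ H).1 (hJ ▸ Subgroup.mem_top g)).le
    have hiso : IsIsotypicOfType (alg ρ H) V S :=
      IsIsotypicOfType.of_isotypicComponent_eq_top (hC ▸ hCtop)
    obtain ⟨s, hs1, hs2, hs3⟩ :=
      IsSemisimpleModule.exists_sSupIndep_sSup_simples_eq_top (alg ρ H) V
    have hfin : Finite s := Set.finite_coe_iff.2 (WellFoundedGT.finite_of_sSupIndep hs1)
    let en := Finite.equivFin s
    refine ⟨Nat.card s, fun i => (en.symm i).1.restrictScalars k, ?_, ?_, ?_, ?_, ?_, ?_⟩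
    · intro i h hh v hv
      exact inv_mem ρ H _ h hh v hv
    · intro i h
      rw [Submodule.restrictScalars_eq_bot_iff] at h
      exact (isSimpleModule_iff_isAtom.1 (hs3 _ (en.symm i).2)).1 h
    · intro i U hU hUinv
      have hle : ofInv ρ H U hUinv ≤ (en.symm i).1 := hU
      rcases (isSimpleModule_iff_isAtom.1 (hs3 _ (en.symm i).2)).le_iff.1 hle with h | h
      · left
        ext v
        exact SetLike.ext_iff.1 h v
      · right
        ext v
        exact SetLike.ext_iff.1 h v
    · exact indep_res ρ H _ (((sSupIndep_iff _).1 hs1).comp en.symm.injective)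
    · rw [← Submodule.restrictScalars_iSup, Submodule.restrictScalars_eq_top_iff,
        en.symm.surjective.iSup_comp (g := fun x : s => (x : Submodule (alg ρ H) V)),
        ← sSup_eq_iSup', hs2]
    · intro i j
      have := hs3 _ (en.symm i).2
      have := hs3 _ (en.symm j).2
      obtain ⟨e1⟩ := hiso (en.symm i).1
      obtain ⟨e2⟩ := hiso (en.symm j).1
      refine ⟨(e1.trans e2.symm).restrictScalars k, ?_⟩
      intro h hh v v' hv
      have hv' : v' = el ρ H h hh • (show (en.symm i).1 from v) := Subtype.ext hv
      have := (e1.trans e2.symm).map_smul (el ρ H h hh) v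
      exact (congrArg (fun x => ((e1.trans e2.symm) x : V)) hv').trans (congrArg Subtype.val this)
  · exfalso
    obtain ⟨T, hT⟩ := exists_transversal (stab ρ H C)
    apply hnotind
    refine ⟨stab ρ H C, C.restrictScalars k, T, hHJ, hJ, ?_, ?_, ?_, hT, ?_, ?_⟩
    · intro j hj v hv
      have : ρ j v ∈ tr ρ H j C := ⟨v, hv, rfl⟩
      rw [(mem_stab ρ H).1 hj] at this
      exact this
    · rwa [Ne, Submodule.restrictScalars_eq_bot_iff]
    · intro U hU hUinv
      by_cases hUb : U = ⊥
      · exact Or.inl hUb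
      right
      let U' := ofInv ρ H U fun h hh => hUinv h (hHJ hh)
      have hU' : U' ≤ C := hU
      have hU'b : U' ≠ ⊥ := by
        intro h
        apply hUb
        ext v
        exact SetLike.ext_iff.1 h v
      have hC1 : C ∈ isotypicComponents (alg ρ H) V := by
        simpa [tr_one] using htrC 1
      have hdis := hind hC1
      have htop : U' ⊔ sSup (isotypicComponents (alg ρ H) V \ {C}) = ⊤ := by
        rw [eq_top_iff, ← iSup_tr ρ H hirr U' hU'b]
        refine iSup_le fun g => ?_
        by_cases hg : g ∈ stab ρ H C
        · refine le_trans ?_ le_sup_left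
          rintro _ ⟨v, hv, rfl⟩
          exact hUinv g hg v hv
        · have hmem : tr ρ H g C ∈ isotypicComponents (alg ρ H) V \ {C} := ⟨htrC g, hg⟩
          exact le_trans (le_trans (tr_mono ρ H g hU') (le_sSup hmem)) le_sup_right
      have hCU : U' = C := by
        have := sup_inf_assoc_of_le (sSup (isotypicComponents (alg ρ H) V \ {C})) hU'
        rw [htop, top_inf_eq, inf_comm, hdis.eq_bot, sup_bot_eq] at this
        exact this.symm
      ext v
      exact SetLike.ext_iff.1 hCU v
    · refine indep_res ρ H (fun t : T => tr ρ H (t : G) C) ?_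
      refine ((sSupIndep_iff _).1 hind).comp
        (f := fun t : T => (⟨tr ρ H (t : G) C, htrC t⟩ : isotypicComponents (alg ρ H) V)) ?_
      intro t t' h
      have h' : tr ρ H (t : G) C = tr ρ H (t' : G) C := congrArg Subtype.val h
      have hm : (t : G)⁻¹ * t' ∈ stab ρ H C := by
        rw [mem_stab, tr_mul, ← h', tr_inv_tr]
      apply Subtype.ext
      exact (hT t').unique ⟨t.2, hm⟩ ⟨t'.2, by simp⟩
    · have : (⨆ t : T, tr ρ H (t : G) C) = ⊤ := by
        rw [eq_top_iff, ← iSup_tr ρ H hirr C hCne]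
        refine iSup_le fun g => ?_
        obtain ⟨t, ⟨ht, htg⟩, -⟩ := hT g
        have : tr ρ H g C = tr ρ H t C := by
          conv_rhs => rw [← (mem_stab ρ H).1 htg, ← tr_mul, mul_inv_cancel_left]
        rw [this]
        exact le_iSup (fun t : T => tr ρ H (t : G) C) ⟨t, ht⟩
      have h2 := congrArg (Submodule.restrictScalars k) this
      rw [Submodule.restrictScalars_iSup] at h2
      exact h2
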